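/- arXiv:1210.6970 — 11 statements merged into one kernel-verified Lean document; each statement's English description precedes it below -/
import Mathlib

section
/- Let A be an m×n real matrix with nonnegative entries. Then rank₊(A) ≥ (ν₊(A) / ‖A‖_F)², i.e. ν₊(A)² ≤ rank₊(A) · ‖A‖_F². -/
open Matrix BigOperators

/-- A symmetric matrix `M` is copositive if `xᵀ M x ≥ 0` for every entrywise
nonnegative vector `x`. -/
def Copositive {k : Type*} [Fintype k] (M : Matrix k k ℝ) : Prop :=
  ∀ x : k → ℝ, (∀ i, 0 ≤ x i) → 0 ≤ x ⬝ᵥ M.mulVec x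

/-- `ν₊(A)`: the supremum of `⟨A, W⟩ = trace(Aᵀ W)` over all `W` such that the
block matrix `[[I, −W], [−Wᵀ, I]]` is copositive. -/
noncomputable def nuPlus {m n : ℕ} (A : Matrix (Fin m) (Fin n) ℝ) : ℝ :=
  sSup {t : ℝ | ∃ W : Matrix (Fin m) (Fin n) ℝ,
    Copositive (Matrix.fromBlocks 1 (-W) (-Wᵀ) 1) ∧ t = Matrix.trace (Aᵀ * W)}

/-- The nonnegative rank: the smallest `r` such that `A = U * V` with `U, V`
entrywise nonnegative. -/
noncomputable def rankPlus {m n : ℕ} (A : Matrix (Fin m) (Fin n) ℝ) : ℕ :=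
  sInf {r : ℕ | ∃ U : Matrix (Fin m) (Fin r) ℝ, ∃ V : Matrix (Fin r) (Fin n) ℝ,
    (∀ i j, 0 ≤ U i j) ∧ (∀ i j, 0 ≤ V i j) ∧ A = U * V}

lemma copos_bilin {m n : ℕ} (W : Matrix (Fin m) (Fin n) ℝ)
    (hW : Copositive (Matrix.fromBlocks 1 (-W) (-Wᵀ) 1))
    (x : Fin m → ℝ) (y : Fin n → ℝ) (hx : ∀ i, 0 ≤ x i) (hy : ∀ j, 0 ≤ y j) :
    2 * (x ⬝ᵥ W.mulVec y) ≤ x ⬝ᵥ x + y ⬝ᵥ y := by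
  have h := hW (Sum.elim x y) (by rintro (i | j) <;> simp [hx, hy])
  rw [Matrix.fromBlocks_mulVec, sumElim_dotProduct_sumElim] at h
  have e : y ⬝ᵥ Wᵀ.mulVec x = x ⬝ᵥ W.mulVec y := by
    rw [Matrix.mulVec_transpose, dotProduct_comm, Matrix.dotProduct_mulVec]
  simp only [Sum.elim_comp_inl, Sum.elim_comp_inr, Matrix.one_mulVec, Matrix.neg_mulVec,
    dotProduct_add, dotProduct_neg, e] at h
  linarith

lemma copos_bilin_sqrt {m n : ℕ} (W : Matrix (Fin m) (Fin n) ℝ)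
    (hW : Copositive (Matrix.fromBlocks 1 (-W) (-Wᵀ) 1))
    (x : Fin m → ℝ) (y : Fin n → ℝ) (hx : ∀ i, 0 ≤ x i) (hy : ∀ j, 0 ≤ y j) :
    x ⬝ᵥ W.mulVec y ≤ √(x ⬝ᵥ x) * √(y ⬝ᵥ y) := by
  have hxx : 0 ≤ x ⬝ᵥ x := Finset.sum_nonneg fun i _ => mul_self_nonneg _
  have hyy : 0 ≤ y ⬝ᵥ y := Finset.sum_nonneg fun i _ => mul_self_nonneg _
  have ha := Real.sqrt_nonneg (x ⬝ᵥ x)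
  have hb := Real.sqrt_nonneg (y ⬝ᵥ y)
  have ha2 := Real.sq_sqrt hxx
  have hb2 := Real.sq_sqrt hyy
  set a := √(x ⬝ᵥ x)
  set b := √(y ⬝ᵥ y)
  rcases ha.eq_or_lt with h0 | ha'
  · have : x = 0 := dotProduct_self_eq_zero.1 (by rw [← ha2, ← h0]; simp)
    rw [← h0]; simp [this]
  rcases hb.eq_or_lt with h0 | hb'
  · have : y = 0 := dotProduct_self_eq_zero.1 (by rw [← hb2, ← h0]; simp)
    rw [← h0]; simp [this]
  have h := copos_bilin W hW (b • x) (a • y) (fun i => mul_nonneg hb (hx i))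
    (fun i => mul_nonneg ha (hy i))
  simp only [Matrix.mulVec_smul, smul_dotProduct, dotProduct_smul, smul_eq_mul] at h
  rw [← ha2, ← hb2] at h
  have hab := mul_pos ha' hb'
  refine le_of_mul_le_mul_left ?_ hab
  nlinarith

lemma trace_sq_bound {m n r : ℕ} (W : Matrix (Fin m) (Fin n) ℝ)
    (hW : Copositive (Matrix.fromBlocks 1 (-W) (-Wᵀ) 1))
    (U : Matrix (Fin m) (Fin r) ℝ) (V : Matrix (Fin r) (Fin n) ℝ)
    (hU : ∀ i j, 0 ≤ U i j) (hV : ∀ i j, 0 ≤ V i j) :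
    Matrix.trace ((U * V)ᵀ * W) ≤ √((r : ℝ) * ∑ i, ∑ j, ((U * V) i j) ^ 2) := by
  have h1 : Matrix.trace ((U * V)ᵀ * W) = ∑ k, (fun i => U i k) ⬝ᵥ W.mulVec (V k) := by
    simp only [Matrix.trace, Matrix.diag, Matrix.mul_apply, Matrix.transpose_apply, dotProduct,
      Matrix.mulVec, Finset.mul_sum, Finset.sum_mul]
    rw [Finset.sum_congr rfl fun j _ => Finset.sum_comm, Finset.sum_comm]
    refine Finset.sum_congr rfl fun k _ => ?_
    rw [Finset.sum_comm]
    refine Finset.sum_congr rfl fun i _ => Finset.sum_congr rfl fun j _ => ?_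
    ring
  have h2 : Matrix.trace ((U * V)ᵀ * W) ≤
      ∑ k, √((fun i => U i k) ⬝ᵥ (fun i => U i k)) * √(V k ⬝ᵥ V k) := by
    rw [h1]
    exact Finset.sum_le_sum fun k _ => copos_bilin_sqrt W hW _ _ (fun i => hU i k) (hV k)
  refine h2.trans (Real.le_sqrt_of_sq_le ?_)
  refine sq_sum_le_card_mul_sum_sq.trans ?_
  simp only [Finset.card_univ, Fintype.card_fin]
  refine mul_le_mul_of_nonneg_left ?_ (Nat.cast_nonneg r)
  have h3 : ∀ k, (√((fun i => U i k) ⬝ᵥ (fun i => U i k)) * √(V k ⬝ᵥ V k)) ^ 2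
      = ∑ i, ∑ j, (U i k * V k j) ^ 2 := by
    intro k
    have e1 : 0 ≤ (fun i => U i k) ⬝ᵥ (fun i => U i k) :=
      Finset.sum_nonneg fun i _ => mul_self_nonneg _
    have e2 : 0 ≤ V k ⬝ᵥ V k := Finset.sum_nonneg fun i _ => mul_self_nonneg _
    rw [mul_pow, Real.sq_sqrt e1, Real.sq_sqrt e2]
    simp only [dotProduct, Finset.sum_mul_sum]
    refine Finset.sum_congr rfl fun i _ => Finset.sum_congr rfl fun j _ => ?_
    ring
  simp only [h3]
  rw [Finset.sum_comm]
  refine Finset.sum_le_sum fun i _ => ?_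
  rw [Finset.sum_comm]
  refine Finset.sum_le_sum fun j _ => ?_
  rw [Matrix.mul_apply]
  have hn : ∀ k, 0 ≤ U i k * V k j := fun k => mul_nonneg (hU i k) (hV k j)
  rw [sq (∑ k, U i k * V k j), Finset.sum_mul]
  refine Finset.sum_le_sum fun k _ => ?_
  rw [sq]
  exact mul_le_mul_of_nonneg_left
    (Finset.single_le_sum (f := fun k => U i k * V k j) (fun l _ => hn l) (Finset.mem_univ k)) (hn k)

/-- For a nonnegative matrix `A`, `rank₊(A) ≥ (ν₊(A) / ‖A‖_F)²`, i.e.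
`ν₊(A)² ≤ rank₊(A) · ‖A‖_F²`. -/
theorem nuPlus_sq_le_rankPlus_mul_frobenius_sq {m n : ℕ}
    (A : Matrix (Fin m) (Fin n) ℝ) (hA : ∀ i j, 0 ≤ A i j) :
    (nuPlus A) ^ 2 ≤ (rankPlus A : ℝ) * (∑ i, ∑ j, (A i j) ^ 2) := by
  obtain ⟨U, V, hU, hV, h⟩ := Nat.sInf_mem (s := {r : ℕ | ∃ U : Matrix (Fin m) (Fin r) ℝ,
      ∃ V : Matrix (Fin r) (Fin n) ℝ, (∀ i j, 0 ≤ U i j) ∧ (∀ i j, 0 ≤ V i j) ∧ A = U * V})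
    ⟨m, 1, A, fun i j => by rw [Matrix.one_apply]; split_ifs <;> norm_num, hA, by simp⟩
  change Matrix (Fin m) (Fin (rankPlus A)) ℝ at U
  change Matrix (Fin (rankPlus A)) (Fin n) ℝ at V
  have hle : ∀ W : Matrix (Fin m) (Fin n) ℝ, Copositive (Matrix.fromBlocks 1 (-W) (-Wᵀ) 1) →
      Matrix.trace (Aᵀ * W) ≤ √((rankPlus A : ℝ) * (∑ i, ∑ j, (A i j) ^ 2)) := by
    intro W hW
    have := trace_sq_bound W hW U V hU hV
    have h' : U * V = A := h.symm
    rwa [h'] at this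
  have hup : nuPlus A ≤ √((rankPlus A : ℝ) * (∑ i, ∑ j, (A i j) ^ 2)) := by
    refine Real.sSup_le ?_ (Real.sqrt_nonneg _)
    rintro t ⟨W, hW, rfl⟩
    exact hle W hW
  have hlo : 0 ≤ nuPlus A := by
    refine le_csSup ⟨√((rankPlus A : ℝ) * (∑ i, ∑ j, (A i j) ^ 2)), ?_⟩ ⟨0, ?_, by simp⟩
    · rintro t ⟨W, hW, rfl⟩
      exact hle W hW
    · intro x _
      simp only [neg_zero, Matrix.transpose_zero, Matrix.fromBlocks_one, Matrix.one_mulVec]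
      exact Finset.sum_nonneg fun i _ => mul_self_nonneg _
  have hnn : 0 ≤ (rankPlus A : ℝ) * (∑ i, ∑ j, (A i j) ^ 2) := by positivity
  calc (nuPlus A) ^ 2 ≤ √((rankPlus A : ℝ) * (∑ i, ∑ j, (A i j) ^ 2)) ^ 2 :=
        pow_le_pow_left₀ hlo hup 2
    _ = _ := Real.sq_sqrt hnn
end

section
/- Let A be an m×n real matrix with nonnegative entries, and let P (m×m) and Q (n×n) be symmetric matrices with nonnegative entries and strictly positive diagonal entries. Then rank₊(A) ≥ ν₊(A;P,Q)² / trace(AᵀPAQ), i.e. ν₊(A;P,Q)² ≤ rank₊(A) · trace(AᵀPAQ). -/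
open Matrix BigOperators

/-- `ν₊(A; P, Q)`: the supremum of `⟨A, W⟩ = trace(Aᵀ W)` over all `W` such that
the block matrix `[[P, −W], [−Wᵀ, Q]]` is copositive. -/
noncomputable def nuPlusPQ {m n : ℕ} (A : Matrix (Fin m) (Fin n) ℝ)
    (P : Matrix (Fin m) (Fin m) ℝ) (Q : Matrix (Fin n) (Fin n) ℝ) : ℝ :=
  sSup {t : ℝ | ∃ W : Matrix (Fin m) (Fin n) ℝ,
    Copositive (Matrix.fromBlocks P (-W) (-Wᵀ) Q) ∧ t = Matrix.trace (Aᵀ * W)}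

theorem aux_disc {a b c : ℝ} (ha : 0 ≤ a) (hb : 0 ≤ b)
    (h : ∀ s t : ℝ, 0 ≤ s → 0 ≤ t → 0 ≤ s ^ 2 * a - 2 * s * t * c + t ^ 2 * b) :
    c ≤ Real.sqrt (a * b) := by
  by_cases hc : c ≤ 0
  · exact hc.trans (Real.sqrt_nonneg _)
  push Not at hc
  apply Real.le_sqrt_of_sq_le
  rcases ha.eq_or_lt with h0 | h0
  · have := h (b + 1) c (by linarith) hc.le
    subst h0
    nlinarith [mul_pos hc hc, mul_nonneg hb (mul_pos hc hc).le]
  · have := h c a hc.le ha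
    by_contra hh
    push Not at hh
    nlinarith [mul_pos h0 (sub_pos.2 hh)]

theorem aux_cop {m n r : ℕ} (P : Matrix (Fin m) (Fin m) ℝ) (Q : Matrix (Fin n) (Fin n) ℝ)
    (W : Matrix (Fin m) (Fin n) ℝ)
    (hW : Copositive (Matrix.fromBlocks P (-W) (-Wᵀ) Q))
    (U : Matrix (Fin m) (Fin r) ℝ) (V : Matrix (Fin r) (Fin n) ℝ)
    (hU : ∀ i j, 0 ≤ U i j) (hV : ∀ i j, 0 ≤ V i j) (k : Fin r) (s t : ℝ)
    (hs : 0 ≤ s) (ht : 0 ≤ t) :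
    0 ≤ s ^ 2 * (Uᵀ * P * U) k k - 2 * s * t * (Uᵀ * W * Vᵀ) k k
      + t ^ 2 * (V * Q * Vᵀ) k k := by
  have h := hW (Sum.elim (s • U.col k) (t • V.row k)) (by
    rintro (i | i)
    · exact mul_nonneg hs (hU _ _)
    · exact mul_nonneg ht (hV _ _))
  have e1 : (Uᵀ * P * U) k k = U.col k ⬝ᵥ P *ᵥ U.col k := by
    rw [Matrix.mul_assoc]; rfl
  have e2 : (Uᵀ * W * Vᵀ) k k = U.col k ⬝ᵥ W *ᵥ V.row k := by
    rw [Matrix.mul_assoc]; rfl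
  have e3 : (V * Q * Vᵀ) k k = V.row k ⬝ᵥ Q *ᵥ V.row k := by
    rw [Matrix.mul_assoc]; rfl
  have e4 : V.row k ⬝ᵥ Wᵀ *ᵥ U.col k = U.col k ⬝ᵥ W *ᵥ V.row k := by
    rw [Matrix.mulVec_transpose, dotProduct_comm, Matrix.dotProduct_mulVec]
  rw [Matrix.fromBlocks_mulVec] at h
  simp only [Sum.elim_comp_inl, Sum.elim_comp_inr, sumElim_dotProduct_sumElim, dotProduct_add,
    Matrix.neg_mulVec, Matrix.mulVec_smul, dotProduct_neg, dotProduct_smul, smul_dotProduct,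
    smul_eq_mul, e4] at h
  rw [e1, e2, e3]
  linarith

/-- For a nonnegative matrix `A` and symmetric nonnegative `P, Q` with strictly
positive diagonals, `ν₊(A;P,Q)² ≤ rank₊(A) · trace(Aᵀ P A Q)`. -/
theorem nuPlusPQ_sq_le_rankPlus_mul_trace {m n : ℕ}
    (A : Matrix (Fin m) (Fin n) ℝ) (hA : ∀ i j, 0 ≤ A i j)
    (P : Matrix (Fin m) (Fin m) ℝ) (Q : Matrix (Fin n) (Fin n) ℝ)
    (hPsymm : P.IsSymm) (hQsymm : Q.IsSymm)
    (hP : ∀ i j, 0 ≤ P i j) (hQ : ∀ i j, 0 ≤ Q i j)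
    (hPdiag : ∀ i, 0 < P i i) (hQdiag : ∀ j, 0 < Q j j) :
    (nuPlusPQ A P Q) ^ 2 ≤ (rankPlus A : ℝ) * Matrix.trace (Aᵀ * P * A * Q) := by
  have hne : rankPlus A ∈ {r : ℕ | ∃ U : Matrix (Fin m) (Fin r) ℝ,
      ∃ V : Matrix (Fin r) (Fin n) ℝ,
      (∀ i j, 0 ≤ U i j) ∧ (∀ i j, 0 ≤ V i j) ∧ A = U * V} := by
    apply Nat.sInf_mem
    refine ⟨n, A, 1, hA, ?_, by simp⟩
    intro i j
    rw [Matrix.one_apply]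
    split_ifs <;> norm_num
  obtain ⟨U, V, hU, hV, hUV⟩ := hne
  generalize rankPlus A = r at *
  set M := Uᵀ * P * U with hM
  set N := V * Q * Vᵀ with hN
  have hM0 : ∀ i j, 0 ≤ M i j := by
    intro i j
    simp only [hM, Matrix.mul_apply, Matrix.transpose_apply]
    exact Finset.sum_nonneg fun x _ => mul_nonneg
      (Finset.sum_nonneg fun y _ => mul_nonneg (hU _ _) (hP _ _)) (hU _ _)
  have hN0 : ∀ i j, 0 ≤ N i j := by
    intro i j
    simp only [hN, Matrix.mul_apply, Matrix.transpose_apply]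
    exact Finset.sum_nonneg fun x _ => mul_nonneg
      (Finset.sum_nonneg fun y _ => mul_nonneg (hV _ _) (hQ _ _)) (hV _ _)
  have hT : Matrix.trace (Aᵀ * P * A * Q) = Matrix.trace (M * N) := by
    rw [hUV, hM, hN, Matrix.transpose_mul]
    have : Vᵀ * Uᵀ * P * (U * V) * Q = Vᵀ * (Uᵀ * P * U * (V * Q)) := by
      simp only [Matrix.mul_assoc]
    rw [this, Matrix.trace_mul_comm]
    simp only [Matrix.mul_assoc]
  have hdiag : ∑ k, M k k * N k k ≤ Matrix.trace (Aᵀ * P * A * Q) := by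
    rw [hT, Matrix.trace]
    refine Finset.sum_le_sum fun k _ => ?_
    rw [Matrix.diag_apply, Matrix.mul_apply]
    exact Finset.single_le_sum (f := fun j => M k j * N j k)
      (fun j _ => mul_nonneg (hM0 _ _) (hN0 _ _)) (Finset.mem_univ k)
  set T := Matrix.trace (Aᵀ * P * A * Q) with hTdef
  have hS0 : 0 ≤ ∑ k, M k k * N k k :=
    Finset.sum_nonneg fun k _ => mul_nonneg (hM0 _ _) (hN0 _ _)
  have hrT : 0 ≤ (r : ℝ) * T := mul_nonneg (Nat.cast_nonneg _) (hS0.trans hdiag)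
  have hub : ∀ t ∈ {t : ℝ | ∃ W : Matrix (Fin m) (Fin n) ℝ,
      Copositive (Matrix.fromBlocks P (-W) (-Wᵀ) Q) ∧ t = Matrix.trace (Aᵀ * W)},
      t ≤ Real.sqrt (r * T) := by
    rintro t ⟨W, hW, rfl⟩
    have h1 : Matrix.trace (Aᵀ * W) = ∑ k, (Uᵀ * W * Vᵀ) k k := by
      rw [hUV, Matrix.transpose_mul, Matrix.mul_assoc, Matrix.trace_mul_comm]
      rfl
    have h2 : Matrix.trace (Aᵀ * W) ≤ ∑ k, Real.sqrt (M k k * N k k) := by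
      rw [h1]
      exact Finset.sum_le_sum fun k _ => aux_disc (hM0 k k) (hN0 k k)
        (fun s t hs ht => aux_cop P Q W hW U V hU hV k s t hs ht)
    refine h2.trans (Real.le_sqrt_of_sq_le ?_)
    have h3 := sq_sum_le_card_mul_sum_sq (s := (Finset.univ : Finset (Fin r)))
      (f := fun k => Real.sqrt (M k k * N k k))
    simp only [Real.sq_sqrt (mul_nonneg (hM0 _ _) (hN0 _ _)), Finset.card_univ,
      Fintype.card_fin] at h3
    exact h3.trans (mul_le_mul_of_nonneg_left hdiag (Nat.cast_nonneg _))
  have hpos : 0 ≤ nuPlusPQ A P Q := by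
    refine le_csSup ⟨_, hub⟩ ⟨0, ?_, by simp⟩
    intro x hx
    refine Finset.sum_nonneg fun i _ => mul_nonneg (hx i) ?_
    rw [Matrix.mulVec, dotProduct]
    refine Finset.sum_nonneg fun j _ => mul_nonneg ?_ (hx j)
    rcases i with i | i <;> rcases j with j | j <;> simp [hP, hQ]
  have hle : nuPlusPQ A P Q ≤ Real.sqrt (r * T) :=
    Real.sSup_le hub (Real.sqrt_nonneg _)
  calc (nuPlusPQ A P Q) ^ 2 ≤ (Real.sqrt (r * T)) ^ 2 := pow_le_pow_left₀ hpos hle 2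
    _ = r * T := Real.sq_sqrt hrT
end

section
/- Let P (m×m) and Q (n×n) be symmetric matrices with nonnegative entries and strictly positive diagonal entries, and let W be an m×n real matrix such that the block matrix [[P, −W], [−Wᵀ, Q]] is copositive. Suppose A = Σᵢ₌₁ʳ λᵢ uᵢvᵢᵀ where each λᵢ ≥ 0, each uᵢ ∈ ℝᵐ and vᵢ ∈ ℝⁿ is entrywise nonnegative, and uᵢᵀPuᵢ = 1 and vᵢᵀQvᵢ = 1 for every i. Then ⟨A, W⟩ = trace(AᵀW) ≤ Σᵢ₌₁ʳ λᵢ. -/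
open Matrix BigOperators

/-- If `[[P, −W], [−Wᵀ, Q]]` is copositive and `A = Σᵢ λᵢ uᵢ vᵢᵀ` with `λᵢ ≥ 0`,
`uᵢ, vᵢ` entrywise nonnegative and `uᵢᵀ P uᵢ = vᵢᵀ Q vᵢ = 1`, then
`⟨A, W⟩ = trace(Aᵀ W) ≤ Σᵢ λᵢ`. -/
theorem trace_le_sum_lambda {m n r : ℕ}
    (P : Matrix (Fin m) (Fin m) ℝ) (Q : Matrix (Fin n) (Fin n) ℝ)
    (hPsymm : P.IsSymm) (hQsymm : Q.IsSymm)
    (hP : ∀ i j, 0 ≤ P i j) (hQ : ∀ i j, 0 ≤ Q i j)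
    (hPdiag : ∀ i, 0 < P i i) (hQdiag : ∀ j, 0 < Q j j)
    (W : Matrix (Fin m) (Fin n) ℝ)
    (hW : Copositive (Matrix.fromBlocks P (-W) (-Wᵀ) Q))
    (lam : Fin r → ℝ) (hlam : ∀ i, 0 ≤ lam i)
    (u : Fin r → Fin m → ℝ) (v : Fin r → Fin n → ℝ)
    (hu : ∀ i a, 0 ≤ u i a) (hv : ∀ i a, 0 ≤ v i a)
    (hunorm : ∀ i, u i ⬝ᵥ P.mulVec (u i) = 1)
    (hvnorm : ∀ i, v i ⬝ᵥ Q.mulVec (v i) = 1)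
    (A : Matrix (Fin m) (Fin n) ℝ)
    (hAdecomp : A = ∑ i, lam i • Matrix.vecMulVec (u i) (v i)) :
    Matrix.trace (Aᵀ * W) ≤ ∑ i, lam i := by
  have key : ∀ i, u i ⬝ᵥ W.mulVec (v i) ≤ 1 := by
    intro i
    have h := hW (Sum.elim (u i) (v i)) (by
      rintro (a | a)
      · exact hu i a
      · exact hv i a)
    have e : v i ⬝ᵥ Wᵀ.mulVec (u i) = u i ⬝ᵥ W.mulVec (v i) := by
      rw [Matrix.mulVec_transpose, dotProduct_comm, ← Matrix.dotProduct_mulVec]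
    rw [Matrix.fromBlocks_mulVec, sumElim_dotProduct_sumElim] at h
    simp only [Sum.elim_comp_inl, Sum.elim_comp_inr, dotProduct_add, Matrix.neg_mulVec,
      dotProduct_neg, hunorm, hvnorm, e] at h
    linarith
  have tr : Matrix.trace (Aᵀ * W) = ∑ i, lam i * (u i ⬝ᵥ W.mulVec (v i)) := by
    rw [hAdecomp, Matrix.transpose_sum, Matrix.sum_mul, Matrix.trace_sum]
    refine Finset.sum_congr rfl fun i _ => ?_
    rw [Matrix.transpose_smul, Matrix.smul_mul, Matrix.trace_smul, smul_eq_mul,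
      Matrix.transpose_vecMulVec, Matrix.vecMulVec_mul, Matrix.trace_vecMulVec,
      dotProduct_comm, ← Matrix.dotProduct_mulVec]
  rw [tr]
  exact Finset.sum_le_sum fun i _ => mul_le_of_le_one_right (hlam i) (key i)
end

section
/- Let P (m×m) and Q (n×n) be symmetric matrices with nonnegative entries. Suppose A = Σᵢ₌₁ʳ λᵢ uᵢvᵢᵀ where each λᵢ ≥ 0, each uᵢ ∈ ℝᵐ and vᵢ ∈ ℝⁿ is entrywise nonnegative, and uᵢᵀPuᵢ = 1 and vᵢᵀQvᵢ = 1 for every i. Then trace(AᵀPAQ) ≥ Σᵢ₌₁ʳ λᵢ². -/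
open Matrix BigOperators

theorem trace_rank_one_aux {m n : ℕ}
    (P : Matrix (Fin m) (Fin m) ℝ) (Q : Matrix (Fin n) (Fin n) ℝ)
    (x z : Fin m → ℝ) (y w : Fin n → ℝ) :
    Matrix.trace ((vecMulVec x y)ᵀ * P * vecMulVec z w * Q)
      = (x ⬝ᵥ P.mulVec z) * (w ⬝ᵥ Q.mulVec y) := by
  rw [Matrix.transpose_vecMulVec, Matrix.vecMulVec_mul, Matrix.vecMulVec_mul_vecMulVec,
    Matrix.vecMulVec_mul, Matrix.trace_vecMulVec, Matrix.smul_vecMul, dotProduct_smul,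
    smul_eq_mul, Matrix.dotProduct_mulVec, Matrix.dotProduct_mulVec, dotProduct_comm y]

theorem bilin_nonneg_aux {m : ℕ} (P : Matrix (Fin m) (Fin m) ℝ) (hP : ∀ i j, 0 ≤ P i j)
    (x z : Fin m → ℝ) (hx : ∀ a, 0 ≤ x a) (hz : ∀ a, 0 ≤ z a) :
    0 ≤ x ⬝ᵥ P.mulVec z :=
  Finset.sum_nonneg fun i _ => mul_nonneg (hx i)
    (by
      simp only [Matrix.mulVec, dotProduct]
      exact Finset.sum_nonneg fun j _ => mul_nonneg (hP i j) (hz j))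

/-- If `P, Q` are symmetric with nonnegative entries and `A = Σᵢ λᵢ uᵢ vᵢᵀ` with
`λᵢ ≥ 0`, `uᵢ, vᵢ` entrywise nonnegative and `uᵢᵀ P uᵢ = vᵢᵀ Q vᵢ = 1`, then
`trace(Aᵀ P A Q) ≥ Σᵢ λᵢ²`. -/
theorem sum_lambda_sq_le_trace {m n r : ℕ}
    (P : Matrix (Fin m) (Fin m) ℝ) (Q : Matrix (Fin n) (Fin n) ℝ)
    (hPsymm : P.IsSymm) (hQsymm : Q.IsSymm)
    (hP : ∀ i j, 0 ≤ P i j) (hQ : ∀ i j, 0 ≤ Q i j)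
    (lam : Fin r → ℝ) (hlam : ∀ i, 0 ≤ lam i)
    (u : Fin r → Fin m → ℝ) (v : Fin r → Fin n → ℝ)
    (hu : ∀ i a, 0 ≤ u i a) (hv : ∀ i a, 0 ≤ v i a)
    (hunorm : ∀ i, u i ⬝ᵥ P.mulVec (u i) = 1)
    (hvnorm : ∀ i, v i ⬝ᵥ Q.mulVec (v i) = 1)
    (A : Matrix (Fin m) (Fin n) ℝ)
    (hAdecomp : A = ∑ i, lam i • Matrix.vecMulVec (u i) (v i)) :
    ∑ i, (lam i) ^ 2 ≤ Matrix.trace (Aᵀ * P * A * Q) := by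
  have key : Matrix.trace (Aᵀ * P * A * Q) = ∑ i, ∑ j, lam i * lam j *
      ((u i ⬝ᵥ P.mulVec (u j)) * (v j ⬝ᵥ Q.mulVec (v i))) := by
    rw [hAdecomp, Matrix.transpose_sum]
    simp only [Matrix.sum_mul, Matrix.mul_sum, Matrix.trace_sum, Matrix.transpose_smul,
      Matrix.smul_mul, Matrix.mul_smul, Matrix.trace_smul, trace_rank_one_aux, smul_eq_mul]
    simp only [Finset.mul_sum]
    rw [Finset.sum_comm]
    refine Finset.sum_congr rfl fun i _ => Finset.sum_congr rfl fun j _ => ?_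
    ring
  rw [key]
  refine Finset.sum_le_sum fun i _ => ?_
  have h := Finset.single_le_sum (f := fun j => lam i * lam j *
      ((u i ⬝ᵥ P.mulVec (u j)) * (v j ⬝ᵥ Q.mulVec (v i))))
    (fun j _ => mul_nonneg (mul_nonneg (hlam i) (hlam j))
      (mul_nonneg (bilin_nonneg_aux P hP _ _ (hu i) (hu j))
        (bilin_nonneg_aux Q hQ _ _ (hv j) (hv i)))) (Finset.mem_univ i)
  simp only [hunorm, hvnorm, mul_one] at h
  rw [pow_two]
  exact h
end

section
/- Let A be an m×n real matrix with nonnegative entries. Then the infimum of Σᵢ ‖uᵢ‖₂·‖vᵢ‖₂ over all finite decompositions A = Σᵢ uᵢvᵢᵀ with all uᵢ ∈ ℝᵐ and vᵢ ∈ ℝⁿ entrywise nonnegative equals the infimum of ½(trace(X) + trace(Y)) over all pairs of matrices X (m×m) and Y (n×n) such that the (m+n)×(m+n) block matrix [[X, A], [Aᵀ, Y]] is completely positive. -/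
open Matrix BigOperators

/-- A symmetric matrix `M` is completely positive if `M = B Bᵀ` for some
entrywise nonnegative matrix `B`. -/
def CompletelyPositive {k : Type*} [Fintype k] (M : Matrix k k ℝ) : Prop :=
  ∃ (s : ℕ) (B : Matrix k (Fin s) ℝ), (∀ i j, 0 ≤ B i j) ∧ M = B * Bᵀ

theorem balance_pair {m n : ℕ} (u : Fin m → ℝ) (v : Fin n → ℝ)
    (hu : ∀ a, 0 ≤ u a) (hv : ∀ a, 0 ≤ v a) :
    ∃ (u' : Fin m → ℝ) (v' : Fin n → ℝ), (∀ a, 0 ≤ u' a) ∧ (∀ a, 0 ≤ v' a) ∧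
      (∀ a b, u' a * v' b = u a * v b) ∧
      (∑ a, u' a * u' a = Real.sqrt (∑ a, (u a) ^ 2) * Real.sqrt (∑ a, (v a) ^ 2)) ∧
      (∑ a, v' a * v' a = Real.sqrt (∑ a, (u a) ^ 2) * Real.sqrt (∑ a, (v a) ^ 2)) := by
  have hp0 : 0 ≤ ∑ a, (u a) ^ 2 := Finset.sum_nonneg fun a _ => sq_nonneg _
  have hq0 : 0 ≤ ∑ a, (v a) ^ 2 := Finset.sum_nonneg fun a _ => sq_nonneg _
  by_cases hp : ∑ a, (u a) ^ 2 = 0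
  · refine ⟨fun _ => 0, fun _ => 0, by simp, by simp, ?_, by simp [hp], by simp [hp]⟩
    intro a b
    have := (Finset.sum_eq_zero_iff_of_nonneg (fun a _ => sq_nonneg (u a))).1 hp a (Finset.mem_univ a)
    have h : u a = 0 := by simpa using this
    simp [h]
  by_cases hq : ∑ a, (v a) ^ 2 = 0
  · refine ⟨fun _ => 0, fun _ => 0, by simp, by simp, ?_, by simp [hq], by simp [hq]⟩
    intro a b
    have := (Finset.sum_eq_zero_iff_of_nonneg (fun a _ => sq_nonneg (v a))).1 hq b (Finset.mem_univ b)
    have h : v b = 0 := by simpa using this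
    simp [h]
  have hP : 0 < Real.sqrt (∑ a, (u a) ^ 2) := Real.sqrt_pos.2 (lt_of_le_of_ne hp0 (Ne.symm hp))
  have hQ : 0 < Real.sqrt (∑ a, (v a) ^ 2) := Real.sqrt_pos.2 (lt_of_le_of_ne hq0 (Ne.symm hq))
  have eP := Real.mul_self_sqrt hp0
  have eQ := Real.mul_self_sqrt hq0
  generalize Real.sqrt (∑ a, (u a) ^ 2) = P at *
  generalize Real.sqrt (∑ a, (v a) ^ 2) = Q at *
  have h1 := Real.mul_self_sqrt (div_pos hQ hP).le
  have h2 := Real.mul_self_sqrt (div_pos hP hQ).le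
  have h3 : Real.sqrt (Q / P) * Real.sqrt (P / Q) = 1 := by
    rw [← Real.sqrt_mul (div_pos hQ hP).le]
    have : Q / P * (P / Q) = 1 := by field_simp
    rw [this, Real.sqrt_one]
  refine ⟨fun a => Real.sqrt (Q / P) * u a, fun a => Real.sqrt (P / Q) * v a,
    fun a => mul_nonneg (Real.sqrt_nonneg _) (hu a),
    fun a => mul_nonneg (Real.sqrt_nonneg _) (hv a), ?_, ?_, ?_⟩
  · intro a b
    linear_combination (u a * v b) * h3
  · have : ∀ a, Real.sqrt (Q / P) * u a * (Real.sqrt (Q / P) * u a) = Q / P * (u a) ^ 2 := by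
      intro a
      linear_combination (u a) ^ 2 * h1
    simp only [this]
    rw [← Finset.mul_sum, ← eP]
    field_simp
  · have : ∀ a, Real.sqrt (P / Q) * v a * (Real.sqrt (P / Q) * v a) = P / Q * (v a) ^ 2 := by
      intro a
      linear_combination (v a) ^ 2 * h2
    simp only [this]
    rw [← Finset.mul_sum, ← eQ]
    field_simp

/-- For a nonnegative matrix `A`, the infimum of `Σᵢ ‖uᵢ‖₂ ‖vᵢ‖₂` over all finite
nonnegative decompositions `A = Σᵢ uᵢ vᵢᵀ` equals the infimum of
`½(trace X + trace Y)` over all `X, Y` such that `[[X, A], [Aᵀ, Y]]` is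
completely positive. -/
theorem nuPlus_decomposition_eq_cp {m n : ℕ}
    (A : Matrix (Fin m) (Fin n) ℝ) (hA : ∀ i j, 0 ≤ A i j) :
    sInf {t : ℝ | ∃ (r : ℕ) (u : Fin r → Fin m → ℝ) (v : Fin r → Fin n → ℝ),
        (∀ i a, 0 ≤ u i a) ∧ (∀ i a, 0 ≤ v i a) ∧
        A = ∑ i, Matrix.vecMulVec (u i) (v i) ∧
        t = ∑ i, Real.sqrt (∑ a, (u i a) ^ 2) * Real.sqrt (∑ a, (v i a) ^ 2)} =
    sInf {t : ℝ | ∃ (X : Matrix (Fin m) (Fin m) ℝ) (Y : Matrix (Fin n) (Fin n) ℝ),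
        CompletelyPositive (Matrix.fromBlocks X A Aᵀ Y) ∧
        t = (Matrix.trace X + Matrix.trace Y) / 2} := by
  set S := {t : ℝ | ∃ (r : ℕ) (u : Fin r → Fin m → ℝ) (v : Fin r → Fin n → ℝ),
        (∀ i a, 0 ≤ u i a) ∧ (∀ i a, 0 ≤ v i a) ∧
        A = ∑ i, Matrix.vecMulVec (u i) (v i) ∧
        t = ∑ i, Real.sqrt (∑ a, (u i a) ^ 2) * Real.sqrt (∑ a, (v i a) ^ 2)} with hS
  set T := {t : ℝ | ∃ (X : Matrix (Fin m) (Fin m) ℝ) (Y : Matrix (Fin n) (Fin n) ℝ),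
        CompletelyPositive (Matrix.fromBlocks X A Aᵀ Y) ∧
        t = (Matrix.trace X + Matrix.trace Y) / 2} with hT
  have hST : S ⊆ T := by
    rintro t ⟨r, u, v, hu, hv, hAe, ht⟩
    choose u' v' hu' hv' huv hpu hpv using fun i => balance_pair (u i) (v i) (hu i) (hv i)
    refine ⟨Matrix.of fun a b => ∑ i, u' i a * u' i b, Matrix.of fun a b => ∑ i, v' i a * v' i b,
      ⟨r, Matrix.of fun k i => Sum.elim (u' i) (v' i) k, ?_, ?_⟩, ?_⟩
    · rintro (a | a) i
      · exact hu' i a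
      · exact hv' i a
    · have hAe' : ∀ a b, A a b = ∑ i, u' i a * v' i b := by
        intro a b
        rw [hAe]
        simp [Matrix.sum_apply, Matrix.vecMulVec_apply, huv]
      ext (a | a) (b | b)
      · simp [Matrix.mul_apply]
      · simp [Matrix.mul_apply, hAe']
      · simp [Matrix.mul_apply, hAe', mul_comm]
      · simp [Matrix.mul_apply]
    · simp only [Matrix.trace, Matrix.diag_apply, Matrix.of_apply]
      rw [Finset.sum_comm, Finset.sum_comm (s := (Finset.univ : Finset (Fin n)))]
      simp only [hpu, hpv]
      rw [ht]
      ring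
  have hTS : ∀ t ∈ T, ∃ s ∈ S, s ≤ t := by
    rintro t ⟨X, Y, ⟨r, B, hB, hM⟩, ht⟩
    have hX : ∀ a b, X a b = ∑ i, B (Sum.inl a) i * B (Sum.inl b) i := by
      intro a b
      have := congrFun (congrFun hM (Sum.inl a)) (Sum.inl b)
      simpa [Matrix.mul_apply] using this
    have hY : ∀ a b, Y a b = ∑ i, B (Sum.inr a) i * B (Sum.inr b) i := by
      intro a b
      have := congrFun (congrFun hM (Sum.inr a)) (Sum.inr b)
      simpa [Matrix.mul_apply] using this
    have hAB : ∀ a b, A a b = ∑ i, B (Sum.inl a) i * B (Sum.inr b) i := by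
      intro a b
      have := congrFun (congrFun hM (Sum.inl a)) (Sum.inr b)
      simpa [Matrix.mul_apply] using this
    refine ⟨_, ⟨r, fun i a => B (Sum.inl a) i, fun i a => B (Sum.inr a) i,
      fun i a => hB _ _, fun i a => hB _ _, ?_, rfl⟩, ?_⟩
    · ext a b
      simp [Matrix.sum_apply, Matrix.vecMulVec_apply, hAB]
    · rw [ht]
      simp only [Matrix.trace, Matrix.diag_apply, hX, hY]
      rw [Finset.sum_comm, Finset.sum_comm (s := (Finset.univ : Finset (Fin n))),
        ← Finset.sum_add_distrib, Finset.sum_div]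
      refine Finset.sum_le_sum fun i _ => ?_
      simp only [← pow_two]
      have e1 := Real.sq_sqrt (Finset.sum_nonneg fun a (_ : a ∈ Finset.univ) =>
        sq_nonneg (B (Sum.inl a : Fin m ⊕ Fin n) i))
      have e2 := Real.sq_sqrt (Finset.sum_nonneg fun a (_ : a ∈ Finset.univ) =>
        sq_nonneg (B (Sum.inr a : Fin m ⊕ Fin n) i))
      have := two_mul_le_add_sq (Real.sqrt (∑ a, (B (Sum.inl a : Fin m ⊕ Fin n) i) ^ 2))
        (Real.sqrt (∑ a, (B (Sum.inr a : Fin m ⊕ Fin n) i) ^ 2))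
      rw [e1, e2] at this
      linarith
  have hS0 : ∀ s ∈ S, 0 ≤ s := by
    rintro s ⟨r, u, v, -, -, -, rfl⟩
    exact Finset.sum_nonneg fun i _ => mul_nonneg (Real.sqrt_nonneg _) (Real.sqrt_nonneg _)
  have hT0 : ∀ t ∈ T, 0 ≤ t := by
    intro t ht
    obtain ⟨s, hs, hst⟩ := hTS t ht
    exact (hS0 s hs).trans hst
  rcases S.eq_empty_or_nonempty with hE | hne
  · have hTE : T = ∅ := by
      apply Set.eq_empty_of_forall_notMem
      intro t ht
      obtain ⟨s, hs, -⟩ := hTS t ht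
      rw [hE] at hs
      exact hs
    rw [hE, hTE]
  · apply le_antisymm
    · refine le_csInf (hne.mono hST) fun t ht => ?_
      obtain ⟨s, hs, hst⟩ := hTS t ht
      exact (csInf_le ⟨0, hS0⟩ hs).trans hst
    · exact csInf_le_csInf ⟨0, hT0⟩ hne hST
end

section
/- Let A be an m×n real matrix with nonnegative entries. Let W be an m×n real matrix such that the block matrix [[I, −W], [−Wᵀ, I]] is copositive, and suppose A = Σᵢ uᵢvᵢᵀ is a finite decomposition with all uᵢ ∈ ℝᵐ and vᵢ ∈ ℝⁿ entrywise nonnegative. Then ⟨A, W⟩ = trace(AᵀW) ≤ Σᵢ ‖uᵢ‖₂·‖vᵢ‖₂. Consequently ν₊(A) is at most the infimum of Σᵢ ‖uᵢ‖₂·‖vᵢ‖₂ over all such nonnegative decompositions of A. -/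
open Matrix BigOperators

theorem bilin_le_of_copositive {m n : ℕ} (W : Matrix (Fin m) (Fin n) ℝ)
    (hW : Copositive (Matrix.fromBlocks 1 (-W) (-Wᵀ) 1))
    (u : Fin m → ℝ) (v : Fin n → ℝ) (hu : ∀ a, 0 ≤ u a) (hv : ∀ a, 0 ≤ v a) :
    u ⬝ᵥ W.mulVec v ≤ Real.sqrt (∑ a, (u a) ^ 2) * Real.sqrt (∑ a, (v a) ^ 2) := by
  have huu : u ⬝ᵥ u = ∑ a, (u a) ^ 2 := by simp [dotProduct, sq]
  have hvv : v ⬝ᵥ v = ∑ a, (v a) ^ 2 := by simp [dotProduct, sq]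
  have hU : 0 ≤ ∑ a, (u a) ^ 2 := Finset.sum_nonneg fun _ _ => sq_nonneg _
  have hV : 0 ≤ ∑ a, (v a) ^ 2 := Finset.sum_nonneg fun _ _ => sq_nonneg _
  have ha2 := Real.sq_sqrt hU
  have hb2 := Real.sq_sqrt hV
  have ha := Real.sqrt_nonneg (∑ a, (u a) ^ 2)
  have hb := Real.sqrt_nonneg (∑ a, (v a) ^ 2)
  rw [← huu] at ha2 ha ⊢
  rw [← hvv] at hb2 hb ⊢
  set a := Real.sqrt (u ⬝ᵥ u)
  set b := Real.sqrt (v ⬝ᵥ v)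
  rcases ha.eq_or_lt with h0 | hapos
  · have : u = 0 := by
      rw [← dotProduct_self_eq_zero (R := ℝ), ← ha2, ← h0]; norm_num
    simp [this, ← h0]
  rcases hb.eq_or_lt with h0 | hbpos
  · have : v = 0 := by
      rw [← dotProduct_self_eq_zero (R := ℝ), ← hb2, ← h0]; norm_num
    simp [this, ← h0]
  have key := hW (Sum.elim (b • u) (a • v)) (by
    rintro (i | i)
    · exact mul_nonneg hb (hu i)
    · exact mul_nonneg ha (hv i))
  have hT : v ⬝ᵥ Wᵀ.mulVec u = u ⬝ᵥ W.mulVec v := by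
    rw [Matrix.mulVec_transpose, dotProduct_comm, ← Matrix.dotProduct_mulVec]
  rw [Matrix.fromBlocks_mulVec, sumElim_dotProduct_sumElim] at key
  simp only [Sum.elim_comp_inl, Sum.elim_comp_inr, Matrix.one_mulVec, Matrix.neg_mulVec,
    Matrix.mulVec_smul, dotProduct_add, dotProduct_neg, smul_dotProduct, dotProduct_smul,
    smul_eq_mul, hT, ← ha2, ← hb2] at key
  have hab := mul_pos hapos hbpos
  have : 0 ≤ (a * b) * (a * b - u ⬝ᵥ W.mulVec v) := by linarith
  have := nonneg_of_mul_nonneg_right this hab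
  linarith

theorem trace_le_aux {m n : ℕ} (A : Matrix (Fin m) (Fin n) ℝ)
    (W : Matrix (Fin m) (Fin n) ℝ)
    (hW : Copositive (Matrix.fromBlocks 1 (-W) (-Wᵀ) 1))
    (r : ℕ) (u : Fin r → Fin m → ℝ) (v : Fin r → Fin n → ℝ)
    (hu : ∀ i a, 0 ≤ u i a) (hv : ∀ i a, 0 ≤ v i a)
    (hA : A = ∑ i, Matrix.vecMulVec (u i) (v i)) :
    Matrix.trace (Aᵀ * W) ≤
      ∑ i, Real.sqrt (∑ a, (u i a) ^ 2) * Real.sqrt (∑ a, (v i a) ^ 2) := by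
  subst hA
  rw [Matrix.transpose_sum, Matrix.sum_mul, Matrix.trace_sum]
  refine Finset.sum_le_sum fun i _ => ?_
  refine le_trans (le_of_eq ?_) (bilin_le_of_copositive W hW (u i) (v i) (hu i) (hv i))
  rw [Matrix.transpose_vecMulVec, Matrix.vecMulVec_mul, Matrix.trace_vecMulVec,
    dotProduct_comm, ← Matrix.dotProduct_mulVec]

/-- If `[[I, −W], [−Wᵀ, I]]` is copositive and `A = Σᵢ uᵢ vᵢᵀ` with all `uᵢ, vᵢ`
entrywise nonnegative, then `⟨A, W⟩ ≤ Σᵢ ‖uᵢ‖₂ ‖vᵢ‖₂`; consequently `ν₊(A)` is at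
most the infimum of `Σᵢ ‖uᵢ‖₂ ‖vᵢ‖₂` over all such decompositions. -/
theorem trace_le_sum_norms_and_nuPlus_le_inf {m n : ℕ}
    (A : Matrix (Fin m) (Fin n) ℝ) (hA : ∀ i j, 0 ≤ A i j) :
    (∀ (W : Matrix (Fin m) (Fin n) ℝ),
      Copositive (Matrix.fromBlocks 1 (-W) (-Wᵀ) 1) →
      ∀ (r : ℕ) (u : Fin r → Fin m → ℝ) (v : Fin r → Fin n → ℝ),
        (∀ i a, 0 ≤ u i a) → (∀ i a, 0 ≤ v i a) →
        A = ∑ i, Matrix.vecMulVec (u i) (v i) →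
        Matrix.trace (Aᵀ * W) ≤
          ∑ i, Real.sqrt (∑ a, (u i a) ^ 2) * Real.sqrt (∑ a, (v i a) ^ 2)) ∧
    nuPlus A ≤
      sInf {t : ℝ | ∃ (r : ℕ) (u : Fin r → Fin m → ℝ) (v : Fin r → Fin n → ℝ),
        (∀ i a, 0 ≤ u i a) ∧ (∀ i a, 0 ≤ v i a) ∧
        A = ∑ i, Matrix.vecMulVec (u i) (v i) ∧
        t = ∑ i, Real.sqrt (∑ a, (u i a) ^ 2) * Real.sqrt (∑ a, (v i a) ^ 2)} := by
  refine ⟨fun W hW r u v hu hv h => trace_le_aux A W hW r u v hu hv h, ?_⟩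
  apply csSup_le
  · refine ⟨_, 0, ?_, rfl⟩
    intro x _
    simp only [neg_zero, Matrix.transpose_zero, Matrix.fromBlocks_one, Matrix.one_mulVec]
    exact Finset.sum_nonneg fun i _ => mul_self_nonneg (x i)
  · rintro _ ⟨W, hW, rfl⟩
    apply le_csInf
    · refine ⟨_, n, fun j i => A i j, fun j => Pi.single j 1, fun j i => hA i j, ?_, ?_, rfl⟩
      · intro j k
        by_cases h : k = j
        · subst h; simp
        · simp [h]
      · ext i j
        simp [Matrix.sum_apply, Matrix.vecMulVec_apply, Pi.single_apply]
    · rintro _ ⟨r, u, v, hu, hv, h, rfl⟩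
      exact trace_le_aux A W hW r u v hu hv h
end

section
/- Let W be an m×n real matrix such that the (m+n)×(m+n) block matrix [[I, −W], [−Wᵀ, I]] is copositive. Then for every entrywise nonnegative vector v ∈ ℝⁿ, ‖Π₊(Wv)‖₂ ≤ ‖v‖₂, where Π₊(x) denotes the entrywise positive part max(x, 0). -/
open Matrix BigOperators

/-- If `[[I, −W], [−Wᵀ, I]]` is copositive, then for every entrywise nonnegative
`v`, `‖Π₊(Wv)‖₂ ≤ ‖v‖₂`, where `Π₊` is the entrywise positive part. -/
theorem norm_posPart_mulVec_le {m n : ℕ} (W : Matrix (Fin m) (Fin n) ℝ)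
    (hW : Copositive (Matrix.fromBlocks 1 (-W) (-Wᵀ) 1))
    (v : Fin n → ℝ) (hv : ∀ i, 0 ≤ v i) :
    Real.sqrt (∑ i, (max (W.mulVec v i) 0) ^ 2) ≤ Real.sqrt (∑ i, (v i) ^ 2) := by
  apply Real.sqrt_le_sqrt
  set u : Fin m → ℝ := fun i => max (W.mulVec v i) 0 with hu
  have h := hW (Sum.elim u v) (by
    rintro (i | i)
    · exact le_max_right _ _
    · exact hv i)
  rw [Matrix.fromBlocks_mulVec, sumElim_dotProduct_sumElim] at h
  simp only [Sum.elim_comp_inl, Sum.elim_comp_inr, Matrix.one_mulVec, Matrix.neg_mulVec,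
    dotProduct_add, dotProduct_neg] at h
  have h1 : v ⬝ᵥ Wᵀ *ᵥ u = u ⬝ᵥ W *ᵥ v := by
    rw [Matrix.mulVec_transpose, dotProduct_comm, Matrix.dotProduct_mulVec]
  have h2 : u ⬝ᵥ W *ᵥ v = u ⬝ᵥ u := by
    unfold dotProduct
    refine Finset.sum_congr rfl fun i _ => ?_
    simp only [hu]
    rcases le_total ((W *ᵥ v) i) 0 with h | h
    · simp [max_eq_right h]
    · simp [max_eq_left h]
  have h3 : ∑ i, (max (W.mulVec v i) 0) ^ 2 = u ⬝ᵥ u := by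
    simp [dotProduct, hu, pow_two]
  have h4 : ∑ i, (v i) ^ 2 = v ⬝ᵥ v := by
    simp [dotProduct, pow_two]
  rw [h1, h2] at h
  rw [h3, h4]
  linarith
end

section
/- Let A be an m×n real matrix with nonnegative entries, and let ν₊⁽⁰⁾(A) be the supremum of ⟨A, W⟩ = trace(AᵀW) over all m×n matrices W for which the block matrix [[I, −W], [−Wᵀ, I]] can be written as the sum of a symmetric matrix with nonnegative entries and a positive semidefinite symmetric matrix. Then rank₊(A) ≥ (ν₊⁽⁰⁾(A) / ‖A‖_F)², i.e. ν₊⁽⁰⁾(A)² ≤ rank₊(A) · ‖A‖_F². -/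
open Matrix BigOperators

/-- `ν₊⁽⁰⁾(A)`: the supremum of `⟨A, W⟩ = trace(Aᵀ W)` over all `W` such that
`[[I, −W], [−Wᵀ, I]]` is the sum of a symmetric entrywise nonnegative matrix and
a positive semidefinite symmetric matrix. -/
noncomputable def nuPlusZero {m n : ℕ} (A : Matrix (Fin m) (Fin n) ℝ) : ℝ :=
  sSup {t : ℝ | ∃ W : Matrix (Fin m) (Fin n) ℝ,
    (∃ N S : Matrix (Fin m ⊕ Fin n) (Fin m ⊕ Fin n) ℝ,
      N.IsSymm ∧ (∀ i j, 0 ≤ N i j) ∧ S.IsSymm ∧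
      (∀ x : Fin m ⊕ Fin n → ℝ, 0 ≤ x ⬝ᵥ S.mulVec x) ∧
      Matrix.fromBlocks 1 (-W) (-Wᵀ) 1 = N + S) ∧
    t = Matrix.trace (Aᵀ * W)}

lemma nuAux_bilin {m n : ℕ} (W : Matrix (Fin m) (Fin n) ℝ)
    (N S : Matrix (Fin m ⊕ Fin n) (Fin m ⊕ Fin n) ℝ)
    (hN : ∀ i j, 0 ≤ N i j)
    (hS : ∀ x : Fin m ⊕ Fin n → ℝ, 0 ≤ x ⬝ᵥ S.mulVec x)
    (h : Matrix.fromBlocks 1 (-W) (-Wᵀ) 1 = N + S)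
    (x : Fin m → ℝ) (y : Fin n → ℝ) (hx : ∀ i, 0 ≤ x i) (hy : ∀ j, 0 ≤ y j) :
    2 * (x ⬝ᵥ W *ᵥ y) ≤ x ⬝ᵥ x + y ⬝ᵥ y := by
  have hz : ∀ i, 0 ≤ (Sum.elim x y) i := by
    rintro (i | i)
    · exact hx i
    · exact hy i
  have h1 : 0 ≤ (Sum.elim x y) ⬝ᵥ (N *ᵥ (Sum.elim x y)) :=
    Finset.sum_nonneg fun i _ => mul_nonneg (hz i)
      (by
        rw [Matrix.mulVec, dotProduct]
        exact Finset.sum_nonneg fun j _ => mul_nonneg (hN i j) (hz j))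
  have h2 := hS (Sum.elim x y)
  have h3 : 0 ≤ (Sum.elim x y) ⬝ᵥ
      ((Matrix.fromBlocks 1 (-W) (-Wᵀ) 1 : Matrix (Fin m ⊕ Fin n) (Fin m ⊕ Fin n) ℝ) *ᵥ
        (Sum.elim x y)) := by
    rw [h, Matrix.add_mulVec, dotProduct_add]
    exact add_nonneg h1 h2
  rw [Matrix.fromBlocks_mulVec, sumElim_dotProduct_sumElim] at h3
  simp only [Sum.elim_comp_inl, Sum.elim_comp_inr, Matrix.one_mulVec, Matrix.neg_mulVec,
    dotProduct_add, dotProduct_neg] at h3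
  have h4 : y ⬝ᵥ Wᵀ *ᵥ x = x ⬝ᵥ W *ᵥ y := by
    rw [Matrix.mulVec_transpose, dotProduct_comm, ← Matrix.dotProduct_mulVec]
  linarith

lemma nuAux_sqrt {m n : ℕ} (W : Matrix (Fin m) (Fin n) ℝ)
    (hW : ∀ (x : Fin m → ℝ) (y : Fin n → ℝ), (∀ i, 0 ≤ x i) → (∀ j, 0 ≤ y j) →
      2 * (x ⬝ᵥ W *ᵥ y) ≤ x ⬝ᵥ x + y ⬝ᵥ y)
    (x : Fin m → ℝ) (y : Fin n → ℝ) (hx : ∀ i, 0 ≤ x i) (hy : ∀ j, 0 ≤ y j) :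
    x ⬝ᵥ W *ᵥ y ≤ √((x ⬝ᵥ x) * (y ⬝ᵥ y)) := by
  rcases le_total (x ⬝ᵥ W *ᵥ y) 0 with hc | hc
  · exact hc.trans (Real.sqrt_nonneg _)
  apply Real.le_sqrt_of_sq_le
  have hp : 0 ≤ x ⬝ᵥ x := Finset.sum_nonneg fun i _ => mul_self_nonneg _
  have hq : 0 ≤ y ⬝ᵥ y := Finset.sum_nonneg fun i _ => mul_self_nonneg _
  have key : ∀ s : ℝ, 0 ≤ (x ⬝ᵥ x) * (s * s) + (-2 * (x ⬝ᵥ W *ᵥ y)) * s + y ⬝ᵥ y := by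
    intro s
    rcases le_total 0 s with hs | hs
    · have := hW (s • x) y (fun i => mul_nonneg hs (hx i)) hy
      simp only [smul_dotProduct, dotProduct_smul, smul_eq_mul] at this
      linarith
    · have h1 := mul_nonneg hp (mul_self_nonneg s)
      have h2 := mul_nonneg hc (neg_nonneg.2 hs)
      linarith
  have := discrim_le_zero key
  unfold discrim at this
  linarith

lemma nuAux_sum_sq {r : ℕ} (f : Fin r → ℝ) (hf : ∀ k, 0 ≤ f k) :
    ∑ k, f k ^ 2 ≤ (∑ k, f k) ^ 2 := by
  rw [sq, Finset.sum_mul]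
  refine Finset.sum_le_sum fun k _ => ?_
  rw [sq]
  exact mul_le_mul_of_nonneg_left
    (Finset.single_le_sum (fun i _ => hf i) (Finset.mem_univ k)) (hf k)

/-- For a nonnegative matrix `A`, `ν₊⁽⁰⁾(A)² ≤ rank₊(A) · ‖A‖_F²`. -/
theorem nuPlusZero_sq_le_rankPlus_mul_frobenius_sq {m n : ℕ}
    (A : Matrix (Fin m) (Fin n) ℝ) (hA : ∀ i j, 0 ≤ A i j) :
    (nuPlusZero A) ^ 2 ≤ (rankPlus A : ℝ) * (∑ i, ∑ j, (A i j) ^ 2) := by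
  have hne : {r : ℕ | ∃ U : Matrix (Fin m) (Fin r) ℝ, ∃ V : Matrix (Fin r) (Fin n) ℝ,
      (∀ i j, 0 ≤ U i j) ∧ (∀ i j, 0 ≤ V i j) ∧ A = U * V}.Nonempty := by
    refine ⟨n, A, 1, hA, fun i j => ?_, by simp⟩
    rw [Matrix.one_apply]
    split_ifs <;> norm_num
  obtain ⟨U, V, hU, hV, hUV⟩ := Nat.sInf_mem hne
  change Matrix (Fin m) (Fin (rankPlus A)) ℝ at U
  change Matrix (Fin (rankPlus A)) (Fin n) ℝ at V
  change A = U * V at hUV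
  have hF : 0 ≤ (rankPlus A : ℝ) * (∑ i, ∑ j, (A i j) ^ 2) := by positivity
  have hd : ∑ k, (U.col k ⬝ᵥ U.col k) * (V.row k ⬝ᵥ V.row k) ≤ ∑ i, ∑ j, (A i j) ^ 2 := by
    calc ∑ k, (U.col k ⬝ᵥ U.col k) * (V.row k ⬝ᵥ V.row k)
        = ∑ k, ∑ i, ∑ j, (U i k * V k j) ^ 2 := by
          refine Finset.sum_congr rfl fun k _ => ?_
          simp only [dotProduct, Matrix.col, Matrix.row, Matrix.transpose_apply,
            Finset.sum_mul_sum]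
          refine Finset.sum_congr rfl fun i _ => Finset.sum_congr rfl fun j _ => by ring
      _ = ∑ i, ∑ j, ∑ k, (U i k * V k j) ^ 2 := by
          rw [Finset.sum_comm]
          refine Finset.sum_congr rfl fun i _ => Finset.sum_comm
      _ ≤ ∑ i, ∑ j, (A i j) ^ 2 := by
          refine Finset.sum_le_sum fun i _ => Finset.sum_le_sum fun j _ => ?_
          have hij : A i j = ∑ k, U i k * V k j := by
            rw [← Matrix.mul_apply, ← hUV]
          rw [hij]
          exact nuAux_sum_sq _ fun k => mul_nonneg (hU i k) (hV k j)
  have hub : nuPlusZero A ≤ √((rankPlus A : ℝ) * (∑ i, ∑ j, (A i j) ^ 2)) := by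
    refine Real.sSup_le ?_ (Real.sqrt_nonneg _)
    rintro t ⟨W, ⟨N, S, -, hN, -, hS, h⟩, rfl⟩
    have hW := nuAux_sqrt W (nuAux_bilin W N S hN hS h)
    have htr : Matrix.trace (Aᵀ * W) = ∑ k, U.col k ⬝ᵥ W *ᵥ V.row k := by
      have e1 : Matrix.trace (Aᵀ * W) = ∑ i, ∑ j, A i j * W i j := by
        simp only [Matrix.trace, Matrix.diag, Matrix.mul_apply, Matrix.transpose_apply]
        exact Finset.sum_comm
      have e2 : ∀ i j, A i j * W i j = ∑ k, U i k * (W i j * V k j) := by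
        intro i j
        have hij : A i j = ∑ k, U i k * V k j := by
          rw [← Matrix.mul_apply, ← hUV]
        rw [hij, Finset.sum_mul]
        exact Finset.sum_congr rfl fun k _ => by ring
      rw [e1]
      simp only [e2, dotProduct, Matrix.mulVec, Matrix.col, Matrix.row, Matrix.transpose_apply,
        Finset.mul_sum]
      refine Eq.trans (Finset.sum_congr rfl fun i _ => Finset.sum_comm) ?_
      exact Finset.sum_comm
    rw [htr]
    refine (Finset.sum_le_sum fun k _ =>
      hW (U.col k) (V.row k) (fun i => hU i k) (fun j => hV k j)).trans ?_
    apply Real.le_sqrt_of_sq_le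
    refine sq_sum_le_card_mul_sum_sq.trans ?_
    rw [Finset.card_univ, Fintype.card_fin]
    refine mul_le_mul_of_nonneg_left (le_trans (le_of_eq ?_) hd) (Nat.cast_nonneg _)
    refine Finset.sum_congr rfl fun k _ => Real.sq_sqrt (mul_nonneg ?_ ?_)
    · exact Finset.sum_nonneg fun i _ => mul_self_nonneg _
    · exact Finset.sum_nonneg fun i _ => mul_self_nonneg _
  have h0 : 0 ≤ nuPlusZero A := by
    refine Real.sSup_nonneg' ⟨0, ⟨0, ⟨0, 1, ?_, fun _ _ => le_rfl, ?_, fun x => ?_, ?_⟩, by simp⟩, le_rfl⟩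
    · simp [Matrix.IsSymm]
    · simp [Matrix.IsSymm]
    · rw [Matrix.one_mulVec]
      exact Finset.sum_nonneg fun i _ => mul_self_nonneg _
    · simp
  calc (nuPlusZero A) ^ 2 ≤ √((rankPlus A : ℝ) * (∑ i, ∑ j, (A i j) ^ 2)) ^ 2 :=
        pow_le_pow_left₀ h0 hub 2
    _ = _ := Real.sq_sqrt hF
end

section
/- Let n ≥ 1, let 𝓕 index the 2n facets of the hypercube [0,1]ⁿ (pairs (k,ε), k ∈ {1,…,n}, ε ∈ {0,1}) and 𝓥 = {0,1}ⁿ its vertices. Let Ŵ be the 2n × 2ⁿ ±1 matrix with Ŵ_{(k,0),v} = 2vₖ − 1 and Ŵ_{(k,1),v} = 1 − 2vₖ (i.e. entry +1 if the vertex is not on the facet and −1 if it is). Let N_𝓕 be the 2n×2n permutation matrix swapping each facet (k,ε) with its opposite facet (k,1−ε), and N_𝓥 the 2ⁿ×2ⁿ permutation matrix sending each vertex v to its bitwise negation v̄. Then for γ = 1/√(2ⁿ⁻¹), the (2n+2ⁿ)×(2n+2ⁿ) block matrix [[I − N_𝓕, −γŴ], [−γŴᵀ, I − N_𝓥]] is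 positive semidefinite. -/
open Matrix BigOperators

/-- The ±1 sign matrix of the slack matrix of the hypercube: entry `+1` if the
vertex is not on the facet, `−1` if it is. Row `(k, false)` is the facet
`xₖ = 0` and row `(k, true)` is the facet `xₖ = 1`. -/
def hatW (n : ℕ) : Matrix (Fin n × Bool) (Fin n → Bool) ℝ :=
  Matrix.of fun fe v =>
    if fe.2 then (if v fe.1 then -1 else 1) else (if v fe.1 then 1 else -1)

/-- The permutation matrix swapping each facet `(k, ε)` with the opposite facet
`(k, 1−ε)`. -/
def negFacets (n : ℕ) : Matrix (Fin n × Bool) (Fin n × Bool) ℝ :=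
  Matrix.of fun fe ge => if ge = (fe.1, !fe.2) then 1 else 0

/-- The permutation matrix sending each vertex `v ∈ {0,1}ⁿ` to its bitwise
negation `v̄`. -/
def negVertices (n : ℕ) : Matrix (Fin n → Bool) (Fin n → Bool) ℝ :=
  Matrix.of fun v w => if w = (fun i => !(v i)) then 1 else 0

theorem hatW_flip (n : ℕ) (k : Fin n) (e : Bool) (v w : Fin n → Bool) (h : w k = !(v k)) :
    hatW n (k, e) w = - hatW n (k, e) v := by
  simp only [hatW, Matrix.of_apply, h]
  cases e <;> cases v k <;> simp

theorem hatW_not (n : ℕ) (k : Fin n) (e : Bool) (v : Fin n → Bool) :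
    hatW n (k, !e) v = - hatW n (k, e) v := by
  simp only [hatW, Matrix.of_apply]
  cases e <;> cases v k <;> simp

theorem hatW_sq (n : ℕ) (k : Fin n) (e : Bool) (v : Fin n → Bool) :
    hatW n (k, e) v * hatW n (k, e) v = 1 := by
  simp only [hatW, Matrix.of_apply]
  cases e <;> cases v k <;> simp

theorem hatW_mul_transpose (n : ℕ) :
    hatW n * (hatW n)ᵀ = (2 ^ n : ℝ) • (1 - negFacets n) := by
  ext ⟨k, e⟩ ⟨l, f⟩
  simp only [Matrix.mul_apply, Matrix.transpose_apply, Matrix.smul_apply, Matrix.sub_apply,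
    Matrix.one_apply, negFacets, Matrix.of_apply, smul_eq_mul, Prod.mk.injEq]
  by_cases hkl : k = l
  · subst hkl
    by_cases hef : e = f
    · subst hef
      simp [hatW_sq]
    · have hf : f = !e := by cases e <;> cases f <;> simp_all
      subst hf
      simp [hatW_not, hatW_sq]
  · have hlk : ¬ l = k := fun h => hkl h.symm
    simp only [hkl, hlk, false_and, if_false, sub_zero, mul_zero]
    let φ : (Fin n → Bool) → (Fin n → Bool) := fun v => Function.update v k (!(v k))
    have hφ : Function.Involutive φ := by
      intro v
      simp [φ]
    have h1 : ∑ v, hatW n (k, e) (φ v) * hatW n (l, f) (φ v)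
        = ∑ v, hatW n (k, e) v * hatW n (l, f) v :=
      Equiv.sum_comp hφ.toPerm (fun v => hatW n (k, e) v * hatW n (l, f) v)
    have h2 : ∀ v, hatW n (k, e) (φ v) * hatW n (l, f) (φ v)
        = - (hatW n (k, e) v * hatW n (l, f) v) := by
      intro v
      rw [hatW_flip n k e v (φ v) (by simp [φ])]
      have : hatW n (l, f) (φ v) = hatW n (l, f) v := by
        simp [hatW, φ, Function.update_of_ne hlk]
      rw [this]; ring
    simp only [h2, Finset.sum_neg_distrib] at h1
    linarith

theorem negVertices_transpose (n : ℕ) : (negVertices n)ᵀ = negVertices n := by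
  ext v w
  simp only [negVertices, Matrix.transpose_apply, Matrix.of_apply]
  congr 1
  apply propext
  constructor <;> (rintro rfl; simp)

theorem mul_negVertices {m : Type*} (n : ℕ) (A : Matrix m (Fin n → Bool) ℝ) (i : m)
    (v : Fin n → Bool) : (A * negVertices n) i v = A i (fun j => !(v j)) := by
  rw [← negVertices_transpose]
  simp [Matrix.mul_apply, negVertices]

theorem hatW_mul_negVertices (n : ℕ) : hatW n * negVertices n = - hatW n := by
  ext ⟨k, e⟩ v
  rw [mul_negVertices, Matrix.neg_apply]
  exact hatW_flip n k e v _ rfl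

theorem negVertices_mul_self (n : ℕ) : negVertices n * negVertices n = 1 := by
  ext v w
  rw [mul_negVertices]
  simp only [negVertices, Matrix.of_apply, Matrix.one_apply]
  congr 1
  apply propext
  constructor
  · intro h
    funext j
    have := congrFun h j
    simpa using this.symm
  · rintro rfl; rfl

/-- For `γ = 1/√(2ⁿ⁻¹)`, the block matrix
`[[I − N_𝓕, −γŴ], [−γŴᵀ, I − N_𝓥]]` is positive semidefinite. -/
theorem posSemidef_hypercube_block (n : ℕ) (hn : 1 ≤ n) :
    Matrix.PosSemidef
      (Matrix.fromBlocks (1 - negFacets n)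
        (-((Real.sqrt (2 ^ (n - 1)))⁻¹ • hatW n))
        (-((Real.sqrt (2 ^ (n - 1)))⁻¹ • hatW n))ᵀ
        (1 - negVertices n)) := by
  set g : ℝ := (Real.sqrt (2 ^ (n - 1)))⁻¹ with hg
  have hg2 : g * g * 2 ^ n = 2 := by
    obtain ⟨m, rfl⟩ : ∃ m, n = m + 1 := ⟨n - 1, by omega⟩
    have h : Real.sqrt (2 ^ m) * Real.sqrt (2 ^ m) = 2 ^ m := Real.mul_self_sqrt (by positivity)
    rw [hg, Nat.add_sub_cancel, ← mul_inv, h, pow_succ]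
    field_simp
  have hNt : (1 - negVertices n)ᵀ = 1 - negVertices n := by
    rw [Matrix.transpose_sub, negVertices_transpose, Matrix.transpose_one]
  have hWN : hatW n * (1 - negVertices n) = (2 : ℝ) • hatW n := by
    rw [Matrix.mul_sub, hatW_mul_negVertices, Matrix.mul_one, two_smul, sub_neg_eq_add]
  have hNW : (1 - negVertices n) * (hatW n)ᵀ = (2 : ℝ) • (hatW n)ᵀ := by
    have := congrArg Matrix.transpose hWN
    rwa [Matrix.transpose_mul, hNt, Matrix.transpose_smul] at this
  have hNN : (1 - negVertices n) * (1 - negVertices n) = (2 : ℝ) • (1 - negVertices n) := by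
    rw [mul_sub, sub_mul, sub_mul, negVertices_mul_self, two_smul]
    simp only [mul_one, one_mul]
    abel
  have key : Matrix.fromBlocks (1 - negFacets n) (-(g • hatW n)) (-(g • hatW n))ᵀ
      (1 - negVertices n) = (1 / 2 : ℝ) •
        ((Matrix.fromCols (-(g • hatW n))ᵀ (1 - negVertices n))ᴴ *
          Matrix.fromCols (-(g • hatW n))ᵀ (1 - negVertices n)) := by
    rw [Matrix.conjTranspose_eq_transpose_of_trivial, Matrix.transpose_fromCols,
      Matrix.fromRows_mul_fromCols, Matrix.fromBlocks_smul, Matrix.transpose_transpose, hNt, hNN]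
    simp only [Matrix.transpose_neg, Matrix.transpose_smul, Matrix.neg_mul, Matrix.mul_neg,
      Matrix.smul_mul, Matrix.mul_smul, hWN, hNW, hatW_mul_transpose, neg_neg, smul_neg, smul_smul]
    congr 1
    · rw [show (1 / 2 : ℝ) * (g * (g * 2 ^ n)) = 1 by linarith, one_smul]
    · congr 2; ring
    · congr 2; ring
    · norm_num
  rw [key]
  exact (Matrix.posSemidef_conjTranspose_mul_self _).smul (by norm_num)
end

section
/- Let A be the 4×4 matrix with rows (1,1,0,0), (1,0,1,0), (0,1,0,1), (0,0,1,1). Then rank(A) = 3 and rank₊(A) = 4. Moreover, for W = (1/√2)(2A − J), the 8×8 block matrix [[I, −W], [−Wᵀ, I]] is the sum of a nonnegative symmetric matrix and a positive semidefinite symmetric matrix, and ⟨A, W⟩ = 4√2 = √(rank₊(A)) · ‖A‖_F. -/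
open Matrix BigOperators

/-- The 4×4 Cohen–Rothblum matrix. -/
noncomputable def crA : Matrix (Fin 4) (Fin 4) ℝ :=
  !![1, 1, 0, 0;
     1, 0, 1, 0;
     0, 1, 0, 1;
     0, 0, 1, 1]

/-- `W = (1/√2)(2A − J)`. -/
noncomputable def crW : Matrix (Fin 4) (Fin 4) ℝ :=
  (Real.sqrt 2)⁻¹ • (2 • crA - Matrix.of fun _ _ => (1 : ℝ))

theorem crA_rank : crA.rank = 3 := by
  apply le_antisymm
  · have h : crA = (!![1,0,0;0,1,0;0,0,1;-1,1,1] : Matrix (Fin 4) (Fin 3) ℝ) *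
        (!![1,1,0,0;1,0,1,0;0,1,0,1] : Matrix (Fin 3) (Fin 4) ℝ) := by
      ext i j
      fin_cases i <;> fin_cases j <;>
        simp [crA, Matrix.mul_apply, Fin.sum_univ_succ]
    rw [h]
    refine (Matrix.rank_mul_le_left _ _).trans ?_
    simpa using Matrix.rank_le_width
      (!![1,0,0;0,1,0;0,0,1;-1,1,1] : Matrix (Fin 4) (Fin 3) ℝ)
  · have h : (1 : Matrix (Fin 3) (Fin 3) ℝ) =
        (!![1,0,0,0;0,1,0,0;0,0,1,0] : Matrix (Fin 3) (Fin 4) ℝ) *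
        (crA * (!![1,0,-1;0,0,1;-1,1,1;0,0,0] : Matrix (Fin 4) (Fin 3) ℝ)) := by
      ext i j
      fin_cases i <;> fin_cases j <;>
        simp [crA, Matrix.mul_apply, Fin.sum_univ_succ]
    have h1 : (1 : Matrix (Fin 3) (Fin 3) ℝ).rank = 3 := by
      rw [Matrix.rank_one]; simp
    rw [← h1, h]
    exact (Matrix.rank_mul_le_right _ _).trans (Matrix.rank_mul_le_left _ _)

theorem crA_rankPlus : rankPlus crA = 4 := by
  apply le_antisymm
  · apply Nat.sInf_le
    refine ⟨crA, 1, ?_, ?_, by simp⟩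
    · intro i j
      fin_cases i <;> fin_cases j <;> simp [crA]
    · intro i j
      rw [Matrix.one_apply]
      split_ifs <;> norm_num
  · apply le_csInf
    · refine ⟨4, crA, 1, ?_, ?_, by simp⟩
      · intro i j
        fin_cases i <;> fin_cases j <;> simp [crA]
      · intro i j
        rw [Matrix.one_apply]
        split_ifs <;> norm_num
    · rintro r ⟨U, V, hU, hV, h⟩
      let s : Fin 4 → Fin 4 := ![1, 0, 3, 2]
      have hA : ∀ i j, crA i j = ∑ k, U i k * V k j := by
        intro i j; rw [h, Matrix.mul_apply]
      have hpos : ∀ i, 0 < crA i (s i) := by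
        intro i; fin_cases i <;> simp [crA, s]
      have hzero : ∀ i j, i ≠ j → crA i (s j) * crA j (s i) = 0 := by
        intro i j; fin_cases i <;> fin_cases j <;> simp [crA, s]
      have hex : ∀ i, ∃ k, 0 < U i k * V k (s i) := by
        intro i
        by_contra! hc
        have h1 := hpos i
        rw [hA] at h1
        exact absurd (Finset.sum_nonpos fun k _ => hc k) (not_le.mpr h1)
      choose f hf using hex
      have hinj : Function.Injective f := by
        intro i j hij
        by_contra hne
        have hUi : ∀ i, 0 < U i (f i) := fun i => pos_of_mul_pos_left (hf i) (hV _ _)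
        have hVi : ∀ i, 0 < V (f i) (s i) := fun i => pos_of_mul_pos_right (hf i) (hU _ _)
        have key : ∀ a b, f a = f b → 0 < crA a (s b) := by
          intro a b hab
          rw [hA]
          have hp : 0 < U a (f a) * V (f a) (s b) :=
            mul_pos (hUi a) (by rw [hab]; exact hVi b)
          exact lt_of_lt_of_le hp (Finset.single_le_sum
            (f := fun k => U a k * V k (s b))
            (fun k _ => mul_nonneg (hU _ _) (hV _ _)) (Finset.mem_univ (f a)))
        exact (mul_pos (key i j hij) (key j i hij.symm)).ne' (hzero i j hne)
      simpa using Fintype.card_le_of_injective f hinj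

/-- The row-swapping permutation matrix. -/
noncomputable def crP : Matrix (Fin 4) (Fin 4) ℝ :=
  !![0,0,0,1;0,0,1,0;0,1,0,0;1,0,0,0]

theorem crP_symm : crPᵀ = crP := by
  ext i j
  fin_cases i <;> fin_cases j <;> simp [crP]

theorem crW_eq : crW = (Real.sqrt 2)⁻¹ •
    (!![1,1,-1,-1;1,-1,1,-1;-1,1,-1,1;-1,-1,1,1] : Matrix (Fin 4) (Fin 4) ℝ) := by
  unfold crW
  congr 1
  ext i j
  fin_cases i <;> fin_cases j <;> simp [crA] <;> norm_num

theorem cr_psd (x : Fin 4 ⊕ Fin 4 → ℝ) :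
    0 ≤ x ⬝ᵥ (Matrix.fromBlocks (1 - crP) (-crW) (-crWᵀ) (1 - crP)).mulVec x := by
  have ht : (Real.sqrt 2)⁻¹ ^ 2 = 1 / 2 := by
    rw [inv_pow, Real.sq_sqrt (by norm_num)]; norm_num
  rw [crW_eq]
  generalize (Real.sqrt 2)⁻¹ = t at *
  have e : x ⬝ᵥ (Matrix.fromBlocks (1 - crP)
      (-(t • (!![1,1,-1,-1;1,-1,1,-1;-1,1,-1,1;-1,-1,1,1] : Matrix (Fin 4) (Fin 4) ℝ)))
      (-(t • (!![1,1,-1,-1;1,-1,1,-1;-1,1,-1,1;-1,-1,1,1] : Matrix (Fin 4) (Fin 4) ℝ))ᵀ)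
      (1 - crP)).mulVec x =
      ((x (.inl 0) - x (.inl 3)) - t * ((x (.inr 0) - x (.inr 3)) + (x (.inr 1) - x (.inr 2)))) ^ 2
      + ((x (.inl 1) - x (.inl 2))
        - t * ((x (.inr 0) - x (.inr 3)) - (x (.inr 1) - x (.inr 2)))) ^ 2 := by
    simp [dotProduct, Matrix.mulVec, Fintype.sum_sum_type, Fin.sum_univ_four, crP,
      Matrix.one_apply]
    linear_combination (-2 * ((x (.inr 0) - x (.inr 3)) ^ 2 + (x (.inr 1) - x (.inr 2)) ^ 2)) * ht
  rw [e]
  positivity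

/-- For the Cohen–Rothblum matrix `A`: `rank A = 3`, `rank₊ A = 4`, the block
matrix `[[I, −W], [−Wᵀ, I]]` with `W = (1/√2)(2A − J)` is the sum of a
nonnegative symmetric matrix and a positive semidefinite symmetric matrix, and
`⟨A, W⟩ = 4√2 = √(rank₊ A) · ‖A‖_F`. -/
theorem cohen_rothblum_example :
    crA.rank = 3 ∧
    rankPlus crA = 4 ∧
    (∃ N S : Matrix (Fin 4 ⊕ Fin 4) (Fin 4 ⊕ Fin 4) ℝ,
      N.IsSymm ∧ (∀ i j, 0 ≤ N i j) ∧ S.IsSymm ∧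
      (∀ x : Fin 4 ⊕ Fin 4 → ℝ, 0 ≤ x ⬝ᵥ S.mulVec x) ∧
      Matrix.fromBlocks 1 (-crW) (-crWᵀ) 1 = N + S) ∧
    Matrix.trace (crAᵀ * crW) = 4 * Real.sqrt 2 ∧
    4 * Real.sqrt 2 =
      Real.sqrt (rankPlus crA) * Real.sqrt (∑ i, ∑ j, (crA i j) ^ 2) := by
  refine ⟨crA_rank, crA_rankPlus, ?_, ?_, ?_⟩
  · refine ⟨Matrix.fromBlocks crP 0 0 crP,
      Matrix.fromBlocks (1 - crP) (-crW) (-crWᵀ) (1 - crP), ?_, ?_, ?_, cr_psd, ?_⟩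
    · simp [Matrix.IsSymm, Matrix.fromBlocks_transpose, crP_symm]
    · have hP : ∀ i j, 0 ≤ crP i j := by
        intro i j
        fin_cases i <;> fin_cases j <;> simp [crP]
      rintro (i | i) (j | j) <;> simp [hP]
    · simp [Matrix.IsSymm, Matrix.fromBlocks_transpose, crP_symm]
    · simp [Matrix.fromBlocks_add]
  · have h2 : (Real.sqrt 2)⁻¹ * 2 = Real.sqrt 2 := by
      rw [inv_mul_eq_div, Real.div_sqrt]
    rw [crW_eq]
    simp [Matrix.trace, Matrix.mul_apply, Fin.sum_univ_four, crA]
    linear_combination 4 * h2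
  · rw [crA_rankPlus]
    have h8 : (∑ i, ∑ j, (crA i j) ^ 2) = 8 := by
      simp [Fin.sum_univ_four, crA]; norm_num
    rw [h8, ← Real.sqrt_mul (by norm_num)]
    rw [show (((4 : ℕ) : ℝ) * 8) = 4 ^ 2 * 2 by norm_num,
      Real.sqrt_mul (by norm_num), Real.sqrt_sq (by norm_num)]
end

section
/- Let A be an n×n diagonal matrix with diagonal entries (β, 1, 1, …, 1) where β > 0, and let P = Q be the diagonal matrix with diagonal entries (1/β, 1, 1, …, 1). Then ν₊(A;P,Q)² / trace(AᵀPAQ) = n, which equals rank₊(A). -/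
open Matrix BigOperators

lemma aux_nu {n : ℕ} (a p : Fin n → ℝ) (ha : ∀ i, 0 < a i) (hp : ∀ i, 0 < p i)
    (hap : ∀ i, a i * p i = 1) :
    nuPlusPQ (Matrix.diagonal a) (Matrix.diagonal p) (Matrix.diagonal p) = n := by
  unfold nuPlusPQ
  apply IsGreatest.csSup_eq
  constructor
  · refine ⟨Matrix.diagonal p, ?_, ?_⟩
    · intro x hx
      have : x ⬝ᵥ (Matrix.fromBlocks (Matrix.diagonal p) (-Matrix.diagonal p)
          (-(Matrix.diagonal p)ᵀ) (Matrix.diagonal p)).mulVec x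
          = ∑ i, p i * (x (Sum.inl i) - x (Sum.inr i)) ^ 2 := by
        rw [Matrix.fromBlocks_mulVec]
        simp only [dotProduct, Fintype.sum_sum_type, ← Finset.sum_add_distrib]
        refine Finset.sum_congr rfl fun i _ => ?_
        simp [Matrix.neg_mulVec, Matrix.mulVec_diagonal]
        ring
      rw [this]
      exact Finset.sum_nonneg fun i _ => mul_nonneg (hp i).le (sq_nonneg _)
    · simp [Matrix.diagonal_transpose, Matrix.trace_diagonal, hap]
  · rintro t ⟨W, hW, rfl⟩
    have hd : ∀ i, W i i ≤ p i := by
      intro i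
      have h := hW (Sum.elim (Pi.single i 1) (Pi.single i 1)) (by
        rintro (j | j) <;> simp only [Sum.elim_inl, Sum.elim_inr, Pi.single_apply] <;>
          split_ifs <;> norm_num)
      rw [Matrix.fromBlocks_mulVec] at h
      simp [dotProduct, Fintype.sum_sum_type, Pi.single_apply, Function.comp_def,
        Matrix.mulVec] at h
      linarith
    calc Matrix.trace ((Matrix.diagonal a)ᵀ * W) = ∑ i, a i * W i i := by
          simp [Matrix.trace, Matrix.diagonal_transpose, Matrix.diagonal_mul]
      _ ≤ ∑ i, a i * p i := Finset.sum_le_sum fun i _ =>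
          mul_le_mul_of_nonneg_left (hd i) (ha i).le
      _ = n := by simp [hap]

lemma aux_rank {n : ℕ} (a : Fin n → ℝ) (ha : ∀ i, 0 < a i) :
    rankPlus (Matrix.diagonal a) = n := by
  unfold rankPlus
  apply IsLeast.csInf_eq
  constructor
  · refine ⟨Matrix.diagonal a, 1, ?_, ?_, by simp⟩
    · intro i j
      rw [Matrix.diagonal_apply]
      split_ifs
      exacts [(ha i).le, le_rfl]
    · intro i j
      rw [Matrix.one_apply]
      split_ifs <;> norm_num
  · rintro r ⟨U, V, -, -, h⟩
    have h1 : (Matrix.diagonal a).rank = n := by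
      rw [Matrix.rank_of_isUnit]
      · simp
      · rw [Matrix.isUnit_iff_isUnit_det, Matrix.det_diagonal, isUnit_iff_ne_zero]
        exact Finset.prod_ne_zero_iff.mpr fun i _ => (ha i).ne'
    have h2 := Matrix.rank_mul_le_left U V
    have h3 := Matrix.rank_le_width U
    rw [← h, h1] at h2
    exact h2.trans h3

/-- For the diagonal matrix `A = diag(β, 1, …, 1)` with `β > 0` and the weight
matrix `P = Q = diag(1/β, 1, …, 1)`, the rescaled lower bound
`ν₊(A;P,Q)² / trace(Aᵀ P A Q)` equals `n`, which equals `rank₊(A)`. -/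
theorem rescaled_bound_sharp_for_diagonal (n : ℕ) (hn : 1 ≤ n) (β : ℝ)
    (hβ : 0 < β) :
    (nuPlusPQ
        (Matrix.diagonal fun i : Fin n => if (i : ℕ) = 0 then β else 1)
        (Matrix.diagonal fun i : Fin n => if (i : ℕ) = 0 then β⁻¹ else 1)
        (Matrix.diagonal fun i : Fin n => if (i : ℕ) = 0 then β⁻¹ else 1)) ^ 2 /
      Matrix.trace
        ((Matrix.diagonal fun i : Fin n => if (i : ℕ) = 0 then β else 1)ᵀ *
         (Matrix.diagonal fun i : Fin n => if (i : ℕ) = 0 then β⁻¹ else 1) *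
         (Matrix.diagonal fun i : Fin n => if (i : ℕ) = 0 then β else 1) *
         (Matrix.diagonal fun i : Fin n => if (i : ℕ) = 0 then β⁻¹ else 1)) =
      (n : ℝ) ∧
    rankPlus (Matrix.diagonal fun i : Fin n => if (i : ℕ) = 0 then β else 1) = n := by
  have ha : ∀ i : Fin n, 0 < (if (i : ℕ) = 0 then β else 1) := by
    intro i; split_ifs <;> positivity
  have hp : ∀ i : Fin n, 0 < (if (i : ℕ) = 0 then β⁻¹ else 1) := by
    intro i; split_ifs <;> positivity
  have hap : ∀ i : Fin n, (if (i : ℕ) = 0 then β else 1) *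
      (if (i : ℕ) = 0 then β⁻¹ else 1) = 1 := by
    intro i
    split_ifs
    · exact mul_inv_cancel₀ hβ.ne'
    · norm_num
  refine ⟨?_, aux_rank _ ha⟩
  rw [aux_nu _ _ ha hp hap]
  have hn0 : (n : ℝ) ≠ 0 := by
    have : n ≠ 0 := by omega
    exact_mod_cast this
  rw [Matrix.diagonal_transpose, Matrix.diagonal_mul_diagonal, Matrix.diagonal_mul_diagonal,
    Matrix.diagonal_mul_diagonal, Matrix.trace_diagonal]
  simp only [hap, one_mul]
  simp
  field_simp
end
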